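/- Let m ≥ 1 and let 1 ≤ p_1 < p_2 < ⋯ < p_m ≤ n. For 1 ≤ i ≤ m set v_i = τ_{p_i}^{p_i}. For 1 ≤ i ≤ m+1 let u_i ∈ W be either the identity or an element with an Ṡ_n-admissible presentation u_i = τ_{a_{i,1}}^{c_{i,1}}·τ_{a_{i,2}}^{c_{i,2}}⋯τ_{a_{i,z_i}}^{c_{i,z_i}} whose τ-indices satisfy p_{i−1} ≤ a_{i,1} (this lower constraint is imposed only for 2 ≤ i ≤ m+1) and a_{i,z_i} ≤ p_i (this upper constraint is imposed only for 1 ≤ i ≤ m). Then the Coxeter length of π = u_1·v_1·u_2·v_2⋯u_m·v_m·u_{m+1} satisfies ℓ(π) = ℓ(u_{m+1}) + Σ_{i=1}^m (−1)^{m−i}·(ℓ(v_i) − ℓ(u_i)), as an equality of integers. -/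

import Mathlib

/-- The Coxeter matrix of type `Bₙ`, with the bond of order `4` between the
generators of indices `0` and `1` (the paper's convention): `s_i² = 1`,
`(s_0·s_1)⁴ = 1`, `(s_i·s_{i+1})³ = 1` for `1 ≤ i ≤ n-2`, and `(s_i·s_j)² = 1`
for `|i-j| ≥ 2`. -/
def BCoxeterMatrix (n : ℕ) : CoxeterMatrix (Fin n) where
  M := Matrix.of fun i j : Fin n ↦
    if i = j then 1
      else if ((i : ℕ) = 0 ∧ (j : ℕ) = 1) ∨ ((j : ℕ) = 0 ∧ (i : ℕ) = 1) then 4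
      else if (j : ℕ) + 1 = i ∨ (i : ℕ) + 1 = j then 3 else 2
  isSymm := by unfold Matrix.IsSymm; aesop
  diagonal := by simp
  off_diagonal := by aesop

variable {n : ℕ} {W : Type*} [Group W]

/-- The simple reflection `s_j` of the Coxeter system, for `0 ≤ j ≤ n-1`
(junk value `1` for `j ≥ n`). -/
def sgen (cs : CoxeterSystem (BCoxeterMatrix n) W) (j : ℕ) : W :=
  if h : j < n then cs.simple ⟨j, h⟩ else 1

/-- `tau cs k` is the element `τ_k = s_0 · s_1 ⋯ s_{k-1}` (with `τ_0 = 1`). -/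
def tau (cs : CoxeterSystem (BCoxeterMatrix n) W) (k : ℕ) : W :=
  ((List.range k).map (sgen cs)).prod

/-- An `Ṡ_n`-admissible presentation of `w ∈ W`: an expression
`w = τ_{k_1}^{i_{k_1}} ⋯ τ_{k_m}^{i_{k_m}}` with `1 ≤ k_1 < ⋯ < k_m ≤ n` and
nonzero integers `i_{k_j}` such that `-k_j ≤ i_{k_j} ≤ k_j - 1` for all `j`,
`Σ_{j=1}^m i_{k_j} = 0`, and `0 ≤ Σ_{j=r}^m i_{k_j} ≤ k_{r-1}` for all `2 ≤ r ≤ m`. -/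
structure IsAdmissible (cs : CoxeterSystem (BCoxeterMatrix n) W) (w : W)
    (m : ℕ) (k : Fin m → ℕ) (i : Fin m → ℤ) : Prop where
  one_le : ∀ j, 1 ≤ k j
  le_n : ∀ j, k j ≤ n
  mono : StrictMono k
  ne_zero : ∀ j, i j ≠ 0
  lb : ∀ j, -(k j : ℤ) ≤ i j
  ub : ∀ j, i j ≤ (k j : ℤ) - 1
  total : ∑ j, i j = 0
  partialSum : ∀ r : ℕ, 1 ≤ r → ∀ hr : r < m,
    0 ≤ (∑ j ∈ Finset.univ.filter (fun j : Fin m => r ≤ (j : ℕ)), i j) ∧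
    (∑ j ∈ Finset.univ.filter (fun j : Fin m => r ≤ (j : ℕ)), i j) ≤
      (k ⟨r - 1, Nat.lt_of_le_of_lt (Nat.sub_le r 1) hr⟩ : ℤ)
  prod_eq : w = ((List.finRange m).map (fun j => tau cs (k j) ^ i j)).prod

/-- The signed transposition underlying `s_i`: it exchanges `i` with `i + 1`, and `-i` with `1 - i`.
Signed permutations are realised as the permutations of `ℤ` that commute with `x ↦ 1 - x`, so that
`x ≤ 0` stands for the negative of the letter `1 - x`. -/
def signedSwapFun (i : ℕ) (x : ℤ) : ℤ :=
  if x = i then i + 1 else if x = i + 1 then i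
  else if x = -i then 1 - i else if x = 1 - i then -i else x

theorem signedSwapFun_spec (i : ℕ) (x : ℤ) :
    (x = i ∧ signedSwapFun i x = i + 1) ∨ (x = i + 1 ∧ signedSwapFun i x = i) ∨
    (x = -i ∧ signedSwapFun i x = 1 - i) ∨ (x = 1 - i ∧ signedSwapFun i x = -i) ∨
    (x ≠ i ∧ x ≠ i + 1 ∧ x ≠ -i ∧ x ≠ 1 - i ∧ signedSwapFun i x = x) := by
  unfold signedSwapFun
  split_ifs <;> omega

theorem signedSwapFun_left (i : ℕ) : signedSwapFun i i = i + 1 := by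
  have := signedSwapFun_spec i i
  omega

theorem signedSwapFun_right (i : ℕ) : signedSwapFun i (i + 1) = i := by
  have := signedSwapFun_spec i (i + 1)
  omega

theorem signedSwapFun_one_sub (i : ℕ) (x : ℤ) :
    signedSwapFun i (1 - x) = 1 - signedSwapFun i x := by
  have := signedSwapFun_spec i x
  have := signedSwapFun_spec i (1 - x)
  omega

theorem signedSwapFun_of_ne {i : ℕ} {x : ℤ} (h₁ : x ≠ i) (h₂ : x ≠ i + 1) (h₃ : x ≠ -i)
    (h₄ : x ≠ 1 - i) : signedSwapFun i x = x := by
  have := signedSwapFun_spec i x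
  omega

theorem signedSwapFun_involutive (i : ℕ) : Function.Involutive (signedSwapFun i) := by
  intro x
  have := signedSwapFun_spec i x
  have := signedSwapFun_spec i (signedSwapFun i x)
  omega

/-- A simple signed transposition reverses only the pairs that it exchanges. -/
theorem signedSwapFun_lt {i : ℕ} {a b : ℤ} (hab : a < b)
    (h : signedSwapFun i b < signedSwapFun i a) :
    (a = i ∧ b = i + 1) ∨ (a = -i ∧ b = 1 - i) := by
  have := signedSwapFun_spec i a
  have := signedSwapFun_spec i b
  omega

/-- `signedSwapFun` as a permutation. -/
def signedSwap (i : ℕ) : Equiv.Perm ℤ := (signedSwapFun_involutive i).toPerm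

@[simp] theorem signedSwap_apply (i : ℕ) (x : ℤ) : signedSwap i x = signedSwapFun i x := rfl

theorem signedSwap_mul_self (i : ℕ) : signedSwap i * signedSwap i = 1 := by
  ext x
  exact signedSwapFun_involutive i x

theorem signedSwap_comm {i j : ℕ} (h : i + 2 ≤ j) :
    signedSwap i * signedSwap j = signedSwap j * signedSwap i := by
  ext x
  simp only [Equiv.Perm.mul_apply, signedSwap_apply]
  have h₁ := signedSwapFun_spec i x
  have h₂ := signedSwapFun_spec j x
  have h₃ := signedSwapFun_spec i (signedSwapFun j x)
  have h₄ := signedSwapFun_spec j (signedSwapFun i x)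
  omega

theorem signedSwap_braid {i : ℕ} (hi : 1 ≤ i) :
    signedSwap i * signedSwap (i + 1) * signedSwap i =
      signedSwap (i + 1) * signedSwap i * signedSwap (i + 1) := by
  ext x
  simp only [Equiv.Perm.mul_apply, signedSwap_apply]
  have h₁ := signedSwapFun_spec i x
  have h₂ := signedSwapFun_spec (i + 1) x
  generalize signedSwapFun i x = y₁ at *
  generalize signedSwapFun (i + 1) x = y₂ at *
  have h₃ := signedSwapFun_spec i y₂
  have h₄ := signedSwapFun_spec (i + 1) y₁
  generalize signedSwapFun i y₂ = z₂ at *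
  generalize signedSwapFun (i + 1) y₁ = z₁ at *
  have h₅ := signedSwapFun_spec i z₁
  have h₆ := signedSwapFun_spec (i + 1) z₂
  push_cast at *
  rcases h₁ with h₁ | h₁ | h₁ | h₁ | h₁ <;> rcases h₂ with h₂ | h₂ | h₂ | h₂ | h₂ <;> omega

theorem signedSwap_four :
    signedSwap 0 * signedSwap 1 * signedSwap 0 * signedSwap 1 =
      signedSwap 1 * signedSwap 0 * signedSwap 1 * signedSwap 0 := by
  ext x
  simp only [Equiv.Perm.mul_apply, signedSwap_apply]
  by_cases h : x = -1 ∨ x = 0 ∨ x = 1 ∨ x = 2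
  · rcases h with rfl | rfl | rfl | rfl <;> decide
  · have h₀ : signedSwapFun 0 x = x :=
      signedSwapFun_of_ne (by omega) (by omega) (by omega) (by omega)
    have h₁ : signedSwapFun 1 x = x :=
        signedSwapFun_of_ne (by omega) (by omega) (by omega) (by omega)
    simp only [h₀, h₁]

/-! ### Relations between the generators -/

section Relations

variable {G : Type*} [Group G] {a b : G}

theorem mul_pow_three_eq_one_iff (ha : a * a = 1) (hb : b * b = 1) :
    (a * b) ^ 3 = 1 ↔ a * b * a = b * a * b := by
  have ha' : a⁻¹ = a := inv_eq_of_mul_eq_one_left ha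
  have hb' : b⁻¹ = b := inv_eq_of_mul_eq_one_left hb
  have : (a * b) ^ 3 = (a * b * a) * (b * a * b) := by
    simp only [pow_succ, pow_zero, one_mul, mul_assoc]
  rw [this, mul_eq_one_iff_eq_inv]
  simp only [mul_inv_rev, ha', hb', mul_assoc]

theorem mul_pow_four_eq_one_iff (ha : a * a = 1) (hb : b * b = 1) :
    (a * b) ^ 4 = 1 ↔ a * b * a * b = b * a * b * a := by
  have ha' : a⁻¹ = a := inv_eq_of_mul_eq_one_left ha
  have hb' : b⁻¹ = b := inv_eq_of_mul_eq_one_left hb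
  have : (a * b) ^ 4 = (a * b * a * b) * (a * b * a * b) := by
    simp only [pow_succ, pow_zero, one_mul, mul_assoc]
  rw [this, mul_eq_one_iff_eq_inv]
  simp only [mul_inv_rev, ha', hb', mul_assoc]

theorem mul_pow_two_eq_one_iff (ha : a * a = 1) (hb : b * b = 1) :
    (a * b) ^ 2 = 1 ↔ a * b = b * a := by
  have ha' : a⁻¹ = a := inv_eq_of_mul_eq_one_left ha
  have hb' : b⁻¹ = b := inv_eq_of_mul_eq_one_left hb
  rw [pow_two, mul_eq_one_iff_eq_inv]
  simp only [mul_inv_rev, ha', hb']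

end Relations

theorem BCoxeterMatrix_zero_one {i j : Fin n} (hi : (i : ℕ) = 0) (hj : (j : ℕ) = 1) :
    BCoxeterMatrix n i j = 4 := by
  have : i ≠ j := by rintro rfl; omega
  simp [BCoxeterMatrix, this, hi, hj]

theorem BCoxeterMatrix_succ {i j : Fin n} (hi : 1 ≤ (i : ℕ)) (hj : (j : ℕ) = i + 1) :
    BCoxeterMatrix n i j = 3 := by
  have : i ≠ j := by rintro rfl; omega
  have h0 : (i : ℕ) ≠ 0 := by omega
  simp [BCoxeterMatrix, this, hj, h0]

theorem BCoxeterMatrix_far {i j : Fin n} (h : (i : ℕ) + 2 ≤ j) :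
    BCoxeterMatrix n i j = 2 := by
  have h1 : i ≠ j := by rintro rfl; omega
  have h2 : (j : ℕ) ≠ 1 := by omega
  have h3 : (j : ℕ) ≠ 0 := by omega
  have h4 : (j : ℕ) + 1 ≠ i := by omega
  have h5 : (i : ℕ) + 1 ≠ j := by omega
  simp [BCoxeterMatrix, h1, h2, h3, h4, h5]

theorem isLiftable_signedSwap :
    (BCoxeterMatrix n).IsLiftable fun i : Fin n => signedSwap i := by
  have key : ∀ i j : Fin n, i < j →
      (signedSwap i * signedSwap j) ^ BCoxeterMatrix n i j = 1 := by
    intro i j hij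
    rw [Fin.lt_def] at hij
    by_cases hfar : (i : ℕ) + 2 ≤ j
    · rw [BCoxeterMatrix_far hfar,
        mul_pow_two_eq_one_iff (signedSwap_mul_self _) (signedSwap_mul_self _)]
      exact signedSwap_comm hfar
    · have hj : (j : ℕ) = i + 1 := by omega
      by_cases hi : (i : ℕ) = 0
      · rw [BCoxeterMatrix_zero_one hi (by omega),
          mul_pow_four_eq_one_iff (signedSwap_mul_self _) (signedSwap_mul_self _), hj, hi]
        exact signedSwap_four
      · rw [BCoxeterMatrix_succ (by omega) hj,
          mul_pow_three_eq_one_iff (signedSwap_mul_self _) (signedSwap_mul_self _), hj]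
        exact signedSwap_braid (by omega)
  intro i j
  rcases lt_trichotomy i j with h | rfl | h
  · exact key i j h
  · simp [signedSwap_mul_self]
  · have := key j i h
    rw [(BCoxeterMatrix n).symmetric j i] at this
    rw [← inv_eq_one, ← inv_pow, mul_inv_rev,
      inv_eq_of_mul_eq_one_left (signedSwap_mul_self _),
      inv_eq_of_mul_eq_one_left (signedSwap_mul_self _)]
    exact this

variable (cs : CoxeterSystem (BCoxeterMatrix n) W)

/-- The action of the Coxeter group by signed permutations. -/
noncomputable def signedPerm : W →* Equiv.Perm ℤ :=
  cs.lift ⟨fun i : Fin n => signedSwap i, isLiftable_signedSwap⟩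

theorem signedPerm_simple (i : Fin n) : signedPerm cs (cs.simple i) = signedSwap i :=
  cs.lift_apply_simple _ i

theorem sgen_of_lt {j : ℕ} (h : j < n) : sgen cs j = cs.simple ⟨j, h⟩ := dif_pos h

theorem signedPerm_sgen {j : ℕ} (h : j < n) : signedPerm cs (sgen cs j) = signedSwap j := by
  rw [sgen_of_lt cs h, signedPerm_simple]

theorem sgen_mul_self (j : ℕ) : sgen cs j * sgen cs j = 1 := by
  unfold sgen
  split_ifs <;> simp

theorem sgen_inv (j : ℕ) : (sgen cs j)⁻¹ = sgen cs j :=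
  inv_eq_of_mul_eq_one_left (sgen_mul_self cs j)

theorem sgen_comm {i j : ℕ} (h : i + 2 ≤ j) : sgen cs i * sgen cs j = sgen cs j * sgen cs i := by
  by_cases hj : j < n
  · rw [← mul_pow_two_eq_one_iff (sgen_mul_self cs i) (sgen_mul_self cs j),
      sgen_of_lt cs hj, sgen_of_lt cs (by omega : i < n),
      ← BCoxeterMatrix_far (n := n) (i := ⟨i, by omega⟩) (j := ⟨j, hj⟩) h]
    exact cs.simple_mul_simple_pow _ _
  · simp [sgen, hj]

theorem sgen_braid {i : ℕ} (hi : 1 ≤ i) (h : i + 1 < n) :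
    sgen cs i * sgen cs (i + 1) * sgen cs i = sgen cs (i + 1) * sgen cs i * sgen cs (i + 1) := by
  rw [← mul_pow_three_eq_one_iff (sgen_mul_self cs _) (sgen_mul_self cs _),
    sgen_of_lt cs h, sgen_of_lt cs (by omega : i < n),
    ← BCoxeterMatrix_succ (n := n) (i := ⟨i, by omega⟩) (j := ⟨i + 1, h⟩) hi rfl]
  exact cs.simple_mul_simple_pow _ _

theorem sgen_four (h : 1 < n) :
    sgen cs 0 * sgen cs 1 * sgen cs 0 * sgen cs 1 =
      sgen cs 1 * sgen cs 0 * sgen cs 1 * sgen cs 0 := by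
  rw [← mul_pow_four_eq_one_iff (sgen_mul_self cs _) (sgen_mul_self cs _),
    sgen_of_lt cs h, sgen_of_lt cs (by omega : 0 < n),
    ← BCoxeterMatrix_zero_one (n := n) (i := ⟨0, by omega⟩) (j := ⟨1, h⟩) rfl rfl]
  exact cs.simple_mul_simple_pow _ _

theorem tau_zero : tau cs 0 = 1 := rfl

theorem tau_succ (k : ℕ) : tau cs (k + 1) = tau cs k * sgen cs k := by
  simp [tau, List.range_succ]

theorem tau_one : tau cs 1 = sgen cs 0 := by rw [tau_succ, tau_zero, one_mul]

theorem tau_mul_sgen_of_lt {i k : ℕ} (h : k < i) :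
    tau cs k * sgen cs i = sgen cs i * tau cs k := by
  induction k with
  | zero => simp [tau_zero]
  | succ k ih =>
    rw [tau_succ, mul_assoc, sgen_comm cs (by omega), ← mul_assoc, ih (by omega), mul_assoc]

theorem tau_mul_sgen {i k : ℕ} (hi : 1 ≤ i) (hik : i + 1 < k) (hk : k ≤ n) :
    tau cs k * sgen cs i = sgen cs (i + 1) * tau cs k := by
  induction k with
  | zero => omega
  | succ k ih =>
    rcases Nat.lt_or_ge (i + 1) k with h | h
    · rw [tau_succ, mul_assoc, ← sgen_comm cs (by omega), ← mul_assoc, ih h (by omega), mul_assoc]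
    · obtain rfl : k = i + 1 := by omega
      rw [tau_succ, tau_succ, mul_assoc, mul_assoc, ← mul_assoc (sgen cs i),
        sgen_braid cs hi (by omega), ← mul_assoc, ← mul_assoc,
        tau_mul_sgen_of_lt cs (Nat.lt_succ_self i)]
      simp only [mul_assoc]

theorem tau_mul_sgen_zero {k : ℕ} (hk₂ : 2 ≤ k) (hk : k ≤ n) :
    tau cs k * sgen cs 0 = sgen cs 1 * sgen cs 0 * sgen cs 1 * tau cs k := by
  induction k, hk₂ using Nat.le_induction with
  | base =>
    rw [tau_succ, tau_one, ← mul_assoc (sgen cs 1 * sgen cs 0 * sgen cs 1),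
      ← sgen_four cs (by omega), mul_assoc _ (sgen cs 1) (sgen cs 1), sgen_mul_self, mul_one]
  | succ k h2 ih =>
    rw [tau_succ, mul_assoc, ← sgen_comm cs (by omega), ← mul_assoc, ih (by omega), mul_assoc]

theorem commute_sgen_zero (h : 1 < n) :
    Commute (sgen cs 0) (sgen cs 1 * sgen cs 0 * sgen cs 1) := by
  have := sgen_four cs h
  simpa [Commute, SemiconjBy, mul_assoc] using this

/-- The standard parabolic subgroup generated by `s_0, …, s_{k-1}`. -/
def parab (k : ℕ) : Subgroup W := Subgroup.closure (sgen cs '' Set.Iio k)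

theorem sgen_mem_parab {i k : ℕ} (h : i < k) : sgen cs i ∈ parab cs k :=
  Subgroup.subset_closure ⟨i, h, rfl⟩

theorem parab_mono {k l : ℕ} (h : k ≤ l) : parab cs k ≤ parab cs l :=
  Subgroup.closure_mono (Set.image_mono (Set.Iio_subset_Iio h))

theorem tau_mem_parab {k l : ℕ} (h : k ≤ l) : tau cs k ∈ parab cs l := by
  refine Subgroup.list_prod_mem _ fun x hx => ?_
  obtain ⟨i, hi, rfl⟩ := List.mem_map.1 hx
  exact sgen_mem_parab cs (by have := List.mem_range.1 hi; omega)

theorem parab_induction {k : ℕ} {P : W → Prop} (one : P 1)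
    (mul : ∀ i < k, ∀ x ∈ parab cs k, P x → P (sgen cs i * x)) {x : W} (hx : x ∈ parab cs k) :
    P x := by
  induction hx using Subgroup.closure_induction_left with
  | one => exact one
  | mul_left s hs y hy ih =>
    obtain ⟨i, hi, rfl⟩ := hs
    exact mul i hi y hy ih
  | inv_mul_cancel s hs y hy ih =>
    obtain ⟨i, hi, rfl⟩ := hs
    rw [sgen_inv]
    exact mul i hi y hy ih

theorem parab_eq_top : parab cs n = ⊤ := by
  rw [eq_top_iff, ← cs.subgroup_closure_range_simple, Subgroup.closure_le]
  rintro _ ⟨i, rfl⟩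
  have := sgen_mem_parab cs i.isLt
  rwa [sgen_of_lt cs i.isLt] at this

/-! ### The signed permutation action -/

theorem signedPerm_one_sub (w : W) (x : ℤ) :
    signedPerm cs w (1 - x) = 1 - signedPerm cs w x := by
  induction w using cs.simple_induction_left generalizing x with
  | one => simp
  | mul_simple_left w i ih =>
    rw [map_mul, Equiv.Perm.mul_apply, Equiv.Perm.mul_apply, ih, signedPerm_simple,
      signedSwap_apply, signedSwap_apply, signedSwapFun_one_sub]

theorem signedPerm_of_lt {k : ℕ} (hk : k ≤ n) {w : W} (hw : w ∈ parab cs k) {x : ℤ} (hx : k < x) :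
    signedPerm cs w x = x := by
  refine parab_induction cs (P := fun w => signedPerm cs w x = x) (by simp) ?_ hw
  intro i hi w _ ih
  rw [map_mul, Equiv.Perm.mul_apply, ih, signedPerm_sgen cs (by omega), signedSwap_apply]
  exact signedSwapFun_of_ne (by omega) (by omega) (by omega) (by omega)

theorem signedPerm_mem_Icc {k : ℕ} (hk : k ≤ n) {w : W} (hw : w ∈ parab cs k) {x : ℤ}
    (hx : x ∈ Set.Icc (1 - k : ℤ) k) : signedPerm cs w x ∈ Set.Icc (1 - k : ℤ) k := by
  refine parab_induction cs (P := fun w => signedPerm cs w x ∈ Set.Icc (1 - k : ℤ) k)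
    (by simpa using hx) ?_ hw
  intro i hi w _ ih
  rw [map_mul, Equiv.Perm.mul_apply, signedPerm_sgen cs (by omega), signedSwap_apply]
  have := signedSwapFun_spec i (signedPerm cs w x)
  simp only [Set.mem_Icc] at ih ⊢
  omega

theorem signedPerm_tau {k : ℕ} (hk : k ≤ n) {x : ℤ} (h₁ : 1 ≤ x) (h₂ : x < k) :
    signedPerm cs (tau cs k) x = x + 1 := by
  induction k with
  | zero => omega
  | succ k ih =>
    rw [tau_succ, map_mul, Equiv.Perm.mul_apply, signedPerm_sgen cs (by omega), signedSwap_apply]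
    rcases eq_or_ne x k with rfl | hne
    · rw [signedSwapFun_left, signedPerm_of_lt cs (by omega) (tau_mem_parab cs le_rfl) (by omega)]
    · rw [signedSwapFun_of_ne (by omega) (by omega) (by omega) (by omega)]
      exact ih (by omega) (by omega)

theorem signedPerm_tau_self {k : ℕ} (hk : k ≤ n) : signedPerm cs (tau cs k) k = 0 := by
  induction k with
  | zero => simp [tau_zero]
  | succ k ih =>
    rw [tau_succ, map_mul, Equiv.Perm.mul_apply, signedPerm_sgen cs (by omega), signedSwap_apply,
      Nat.cast_succ, signedSwapFun_right]
    exact ih (by omega)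

theorem signedPerm_tau_of_nonpos {k : ℕ} (hk : k ≤ n) {x : ℤ} (h₁ : 1 - k < x) (h₂ : x ≤ 0) :
    signedPerm cs (tau cs k) x = x - 1 := by
  have h := signedPerm_one_sub cs (tau cs k) (1 - x)
  rw [sub_sub_cancel, signedPerm_tau cs hk (x := 1 - x) (by omega) (by omega)] at h
  omega

theorem signedPerm_tau_pow {k s : ℕ} (hk : k ≤ n) (hs : s ≤ k) {x : ℤ} (h₁ : 1 ≤ x) (h₂ : x ≤ k) :
    signedPerm cs (tau cs k ^ s) x = if x ≤ k - s then x + s else k - s + 1 - x := by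
  induction s with
  | zero => simp [h₂]
  | succ s ih =>
    rw [pow_succ', map_mul, Equiv.Perm.mul_apply, ih (by omega)]
    push_cast
    rcases lt_trichotomy x ((k : ℤ) - s) with h | h | h
    · rw [if_pos (by omega), if_pos (by omega), signedPerm_tau cs hk (by omega) (by omega)]
      ring
    · rw [if_pos (by omega), if_neg (by omega), show x + s = k by omega, signedPerm_tau_self cs hk]
      omega
    · rw [if_neg (by omega), if_neg (by omega),
        signedPerm_tau_of_nonpos cs hk (by omega) (by omega)]
      ring

/-! ### Faithfulness -/

theorem tau_inv_mul_sgen {i k : ℕ} (hi : 2 ≤ i) (hik : i < k) (hk : k ≤ n) :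
    (tau cs k)⁻¹ * sgen cs i = sgen cs (i - 1) * (tau cs k)⁻¹ := by
  have h := tau_mul_sgen cs (i := i - 1) (k := k) (by omega) (by omega) hk
  rw [Nat.sub_add_cancel (by omega)] at h
  rw [inv_mul_eq_iff_eq_mul, ← mul_assoc, h, mul_inv_cancel_right]

theorem tau_inv_mul_conj {k : ℕ} (hk₂ : 2 ≤ k) (hk : k ≤ n) :
    (tau cs k)⁻¹ * (sgen cs 1 * sgen cs 0 * sgen cs 1) = sgen cs 0 * (tau cs k)⁻¹ := by
  rw [inv_mul_eq_iff_eq_mul, ← mul_assoc, tau_mul_sgen_zero cs hk₂ hk, mul_inv_cancel_right]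

/-- Coset decomposition of the parabolic subgroup of rank `k + 1` with respect to the one of
rank `k`. -/
theorem exists_coset_form {k : ℕ} (hk : k + 1 ≤ n) {w : W} (hw : w ∈ parab cs (k + 1)) :
    ∃ x ∈ parab cs k, ∃ e, (e = 1 ∨ e = sgen cs 0) ∧ ∃ j ≤ k + 1,
      w = x * ((tau cs (k + 1))⁻¹ * (e * tau cs j)) := by
  rw [← inv_inv w]
  refine parab_induction cs (P := fun w => ∃ x ∈ parab cs k, ∃ e, (e = 1 ∨ e = sgen cs 0) ∧
    ∃ j ≤ k + 1, w⁻¹ = x * ((tau cs (k + 1))⁻¹ * (e * tau cs j))) ?_ ?_ (inv_mem hw)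
  · exact ⟨1, one_mem _, 1, Or.inl rfl, k + 1, le_rfl, by simp⟩
  rintro i hi y - ⟨x, hx, e, he, j, hj, hy⟩
  have he₂ : ∀ a, 2 ≤ a → e * sgen cs a = sgen cs a * e := by
    intro a ha
    rcases he with rfl | rfl
    · simp
    · exact sgen_comm cs (by omega)
  have far : ∀ a, 2 ≤ a → a ≤ k → tau cs j * sgen cs i = sgen cs a * tau cs j →
      ∃ x ∈ parab cs k, ∃ e, (e = 1 ∨ e = sgen cs 0) ∧ ∃ j ≤ k + 1,
        (sgen cs i * y)⁻¹ = x * ((tau cs (k + 1))⁻¹ * (e * tau cs j)) := by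
    intro a ha hak h
    refine ⟨x * sgen cs (a - 1), mul_mem hx (sgen_mem_parab cs (by omega)), e, he, j, hj, ?_⟩
    have h' := tau_inv_mul_sgen cs ha (Nat.lt_succ_of_le hak) hk
    rw [mul_inv_rev, sgen_inv, hy]
    calc x * ((tau cs (k + 1))⁻¹ * (e * tau cs j)) * sgen cs i
        = x * ((tau cs (k + 1))⁻¹ * (e * (tau cs j * sgen cs i))) := by simp only [mul_assoc]
      _ = x * ((tau cs (k + 1))⁻¹ * (e * sgen cs a * tau cs j)) := by rw [h, mul_assoc e]
      _ = x * (((tau cs (k + 1))⁻¹ * sgen cs a) * (e * tau cs j)) := by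
          rw [he₂ a ha]; simp only [mul_assoc]
      _ = _ := by rw [h']; simp only [mul_assoc]
  have near : ∀ e' j', (e' = 1 ∨ e' = sgen cs 0) → j' ≤ k + 1 →
      e * (tau cs j * sgen cs i) = e' * tau cs j' →
      ∃ x ∈ parab cs k, ∃ e, (e = 1 ∨ e = sgen cs 0) ∧ ∃ j ≤ k + 1,
        (sgen cs i * y)⁻¹ = x * ((tau cs (k + 1))⁻¹ * (e * tau cs j)) := by
    intro e' j' he' hj' h
    refine ⟨x, hx, e', he', j', hj', ?_⟩
    rw [mul_inv_rev, sgen_inv, hy, ← h]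
    simp only [mul_assoc]
  rcases lt_trichotomy i j with hij | rfl | hij
  · obtain ⟨j, rfl⟩ : ∃ j', j = j' + 1 := ⟨j - 1, by omega⟩
    rcases Nat.lt_or_ge i j with hij' | hij'
    · rcases Nat.eq_zero_or_pos i with rfl | hi0
      · refine ⟨x * sgen cs 0, mul_mem hx (sgen_mem_parab cs (by omega)), e, he, j + 1, hj, ?_⟩
        have h := tau_mul_sgen_zero cs (k := j + 1) (by omega) (by omega)
        have h' := tau_inv_mul_conj cs (k := k + 1) (by omega) hk
        have he₃ : e * (sgen cs 1 * sgen cs 0 * sgen cs 1) =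
            sgen cs 1 * sgen cs 0 * sgen cs 1 * e := by
          rcases he with rfl | rfl
          · simp
          · exact commute_sgen_zero cs (by omega)
        rw [mul_inv_rev, sgen_inv, hy]
        calc x * ((tau cs (k + 1))⁻¹ * (e * tau cs (j + 1))) * sgen cs 0
            = x * ((tau cs (k + 1))⁻¹ * (e * (tau cs (j + 1) * sgen cs 0))) := by
              simp only [mul_assoc]
          _ = x * ((tau cs (k + 1))⁻¹ *
                (e * (sgen cs 1 * sgen cs 0 * sgen cs 1) * tau cs (j + 1))) := by
              rw [h, mul_assoc e]
          _ = x * ((tau cs (k + 1))⁻¹ * (sgen cs 1 * sgen cs 0 * sgen cs 1) *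
                (e * tau cs (j + 1))) := by rw [he₃]; simp only [mul_assoc]
          _ = _ := by rw [h']; simp only [mul_assoc]
      · exact far (i + 1) (by omega) (by omega) (tau_mul_sgen cs hi0 (by omega) (by omega))
    · obtain rfl : i = j := by omega
      exact near e i he (by omega) (by rw [tau_succ, mul_assoc (tau cs i), sgen_mul_self, mul_one])
  · exact near e (i + 1) he hi (by rw [tau_succ])
  · rcases Nat.lt_or_ge i 2 with h2 | h2
    · obtain rfl : i = 1 := by omega
      obtain rfl : j = 0 := by omega
      have h : tau cs 2 = sgen cs 0 * sgen cs 1 := by rw [tau_succ, tau_one]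
      rcases he with rfl | rfl
      · exact near _ 2 (Or.inr rfl) (by omega)
          (by rw [h, ← mul_assoc (sgen cs 0), sgen_mul_self, tau_zero, one_mul])
      · exact near _ 2 (Or.inl rfl) (by omega) (by rw [h, tau_zero, one_mul, one_mul])
    · exact far i h2 (by omega) (tau_mul_sgen_of_lt cs hij)

theorem eq_one_of_signedPerm_eq_one {k : ℕ} (hk : k ≤ n) {w : W} (hw : w ∈ parab cs k)
    (h : signedPerm cs w = 1) : w = 1 := by
  induction k generalizing w with
  | zero => simpa [parab] using hw
  | succ k ih =>
    obtain ⟨x, hx, e, he, j, hj, rfl⟩ := exists_coset_form cs hk hw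
    suffices hc : (tau cs (k + 1))⁻¹ * (e * tau cs j) = 1 by
      rw [hc, mul_one] at h ⊢
      exact ih (by omega) hx h
    have hfix : signedPerm cs x⁻¹ ((k + 1 : ℕ) : ℤ) = (k + 1 : ℕ) :=
      signedPerm_of_lt cs (by omega) (inv_mem hx) (by push_cast; omega)
    rw [map_mul, mul_eq_one_iff_inv_eq, ← map_inv] at h
    rw [h, map_mul, map_inv, Equiv.Perm.mul_apply, Equiv.Perm.inv_eq_iff_eq,
      signedPerm_tau_self cs hk, map_mul, Equiv.Perm.mul_apply] at hfix
    rcases hj.lt_or_eq with hlt | rfl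
    · rw [signedPerm_of_lt cs (by omega) (tau_mem_parab cs le_rfl) (by exact_mod_cast hlt)] at hfix
      rcases he with rfl | rfl
      · simp at hfix
        omega
      · rw [signedPerm_sgen cs (by omega), signedSwap_apply] at hfix
        have := signedSwapFun_spec 0 ((k + 1 : ℕ) : ℤ)
        obtain rfl : k = 0 := by omega
        obtain rfl : j = 0 := by omega
        simp [tau_one, tau_zero]
    · rw [signedPerm_tau_self cs hk] at hfix
      rcases he with rfl | rfl
      · simp
      · rw [signedPerm_sgen cs (by omega), signedSwap_apply] at hfix
        have := signedSwapFun_spec 0 0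
        omega

theorem signedPerm_injective : Function.Injective (signedPerm cs) :=
  (injective_iff_map_eq_one _).2 fun w hw =>
    eq_one_of_signedPerm_eq_one cs le_rfl (parab_eq_top cs ▸ Subgroup.mem_top w) hw

/-! ### Descents -/

theorem signedPerm_conj {g : W} {i j : ℕ} (hi : i < n) (hj : j < n)
    (h : (signedPerm cs g i = j ∧ signedPerm cs g (i + 1) = j + 1) ∨
      (signedPerm cs g i = -j ∧ signedPerm cs g (i + 1) = 1 - j)) :
    g * sgen cs i * g⁻¹ = sgen cs j := by
  rw [mul_inv_eq_iff_eq_mul]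
  refine signedPerm_injective cs (Equiv.ext fun x => ?_)
  simp only [map_mul, Equiv.Perm.mul_apply, signedPerm_sgen cs hi, signedPerm_sgen cs hj,
    signedSwap_apply]
  have h₁ := signedPerm_one_sub cs g i
  have h₂ := signedPerm_one_sub cs g (i + 1)
  rw [show (1 : ℤ) - (i + 1) = -i by ring] at h₂
  have hspec := signedSwapFun_spec j (signedPerm cs g x)
  rcases signedSwapFun_spec i x with ⟨rfl, e⟩ | ⟨rfl, e⟩ | ⟨rfl, e⟩ | ⟨rfl, e⟩ | ⟨e₁, e₂, e₃, e₄, e⟩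
  · rw [e]; omega
  · rw [e]; omega
  · rw [e]; omega
  · rw [e]; omega
  · rw [e]
    have e₁ := (signedPerm cs g).injective.ne e₁
    have e₂ := (signedPerm cs g).injective.ne e₂
    have e₃ := (signedPerm cs g).injective.ne e₃
    have e₄ := (signedPerm cs g).injective.ne e₄
    omega

/-- If `w⁻¹` reverses the positive root of a reflection, then multiplying a word for `w` by this
reflection amounts to deleting a letter. -/
theorem exists_deletion (ω : List (Fin n)) {g : W} {i : ℕ} (hi : i < n)
    (hg : signedPerm cs g i < signedPerm cs g (i + 1))
    (h : signedPerm cs (cs.wordProd ω)⁻¹ (signedPerm cs g (i + 1)) <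
      signedPerm cs (cs.wordProd ω)⁻¹ (signedPerm cs g i)) :
    ∃ ω' : List (Fin n), ω'.length < ω.length ∧
      g * sgen cs i * g⁻¹ * cs.wordProd ω = cs.wordProd ω' := by
  induction ω generalizing g with
  | nil => simp at h; omega
  | cons j ω ih =>
    have hs : ∀ x, signedPerm cs (cs.simple j * g) x = signedSwapFun j (signedPerm cs g x) := by
      intro x
      rw [map_mul, Equiv.Perm.mul_apply, signedPerm_simple, signedSwap_apply]
    have hne : signedPerm cs (cs.simple j * g) i ≠ signedPerm cs (cs.simple j * g) (i + 1) :=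
      (signedPerm cs _).injective.ne (by omega)
    rcases hne.lt_or_gt with hlt | hgt
    · have hw : ∀ x, signedPerm cs (cs.wordProd (j :: ω))⁻¹ (signedPerm cs g x) =
          signedPerm cs (cs.wordProd ω)⁻¹ (signedPerm cs (cs.simple j * g) x) := by
        intro x
        rw [cs.wordProd_cons, mul_inv_rev, cs.inv_simple]
        simp only [map_mul, Equiv.Perm.mul_apply]
      rw [hw, hw] at h
      obtain ⟨ω', hlen, hω'⟩ := ih hlt h
      refine ⟨j :: ω', by simpa using hlen, ?_⟩
      rw [cs.wordProd_cons, cs.wordProd_cons, ← hω', mul_inv_rev, cs.inv_simple]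
      simp only [mul_assoc, cs.simple_mul_simple_cancel_left]
    · rw [hs, hs] at hgt
      refine ⟨ω, by simp, ?_⟩
      rw [signedPerm_conj cs hi j.isLt (signedSwapFun_lt hg hgt), cs.wordProd_cons,
        sgen_of_lt cs j.isLt, cs.simple_mul_simple_cancel_left]

theorem length_sgen_mul_of_desc {w : W} {i : ℕ} (hi : i < n)
    (h : signedPerm cs w⁻¹ (i + 1) < signedPerm cs w⁻¹ i) :
    cs.length (sgen cs i * w) + 1 = cs.length w := by
  obtain ⟨ω, hω, rfl⟩ := cs.exists_isReduced w
  obtain ⟨ω', hlen, hω'⟩ := exists_deletion cs ω (g := 1) hi (by simp) (by simpa using h)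
  have hle := cs.length_wordProd_le ω'
  rw [← hω', one_mul, inv_one, mul_one] at hle
  have := hω.eq
  have := cs.length_simple_mul (cs.wordProd ω) ⟨i, hi⟩
  rw [← sgen_of_lt cs hi] at this
  omega

theorem length_sgen_mul_of_not_desc {w : W} {i : ℕ} (hi : i < n)
    (h : signedPerm cs w⁻¹ i < signedPerm cs w⁻¹ (i + 1)) :
    cs.length (sgen cs i * w) = cs.length w + 1 := by
  have key := length_sgen_mul_of_desc cs (w := sgen cs i * w) hi (by
    rw [mul_inv_rev, sgen_inv]
    simpa only [map_mul, Equiv.Perm.mul_apply, signedPerm_sgen cs hi, signedSwap_apply,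
      signedSwapFun_left, signedSwapFun_right] using h)
  rw [← mul_assoc, sgen_mul_self, one_mul] at key
  omega

theorem length_mul_of_strictMonoOn {p : ℕ} (hp : p ≤ n) {x g : W} (hx : x ∈ parab cs p)
    (hg : StrictMonoOn (signedPerm cs g⁻¹) (Set.Icc (1 - p : ℤ) p)) :
    cs.length (x * g) = cs.length x + cs.length g := by
  refine parab_induction cs (P := fun x => cs.length (x * g) = cs.length x + cs.length g)
    (by simp) ?_ hx
  intro i hi x hx ih
  have hin : i < n := by omega
  have m₁ := signedPerm_mem_Icc cs hp (inv_mem hx) (x := i) ⟨by omega, by omega⟩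
  have m₂ := signedPerm_mem_Icc cs hp (inv_mem hx) (x := i + 1) ⟨by omega, by omega⟩
  have hxg : ∀ y, signedPerm cs (x * g)⁻¹ y = signedPerm cs g⁻¹ (signedPerm cs x⁻¹ y) := by
    intro y
    rw [mul_inv_rev, map_mul, Equiv.Perm.mul_apply]
  have hne : signedPerm cs x⁻¹ i ≠ signedPerm cs x⁻¹ (i + 1) :=
    (signedPerm cs _).injective.ne (by omega)
  rw [mul_assoc]
  rcases hne.lt_or_gt with h | h
  · have e₁ := length_sgen_mul_of_not_desc cs hin h
    have e₂ := length_sgen_mul_of_not_desc cs hin (w := x * g) (by rw [hxg, hxg]; exact hg m₁ m₂ h)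
    omega
  · have e₁ := length_sgen_mul_of_desc cs hin h
    have e₂ := length_sgen_mul_of_desc cs hin (w := x * g) (by rw [hxg, hxg]; exact hg m₂ m₁ h)
    omega

theorem length_mul_of_strictAntiOn {p : ℕ} (hp : p ≤ n) {x g : W} (hx : x ∈ parab cs p)
    (hg : StrictAntiOn (signedPerm cs g⁻¹) (Set.Icc (1 - p : ℤ) p)) :
    cs.length (x * g) + cs.length x = cs.length g := by
  refine parab_induction cs (P := fun x => cs.length (x * g) + cs.length x = cs.length g)
    (by simp) ?_ hx
  intro i hi x hx ih
  have hin : i < n := by omega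
  have m₁ := signedPerm_mem_Icc cs hp (inv_mem hx) (x := i) ⟨by omega, by omega⟩
  have m₂ := signedPerm_mem_Icc cs hp (inv_mem hx) (x := i + 1) ⟨by omega, by omega⟩
  have hxg : ∀ y, signedPerm cs (x * g)⁻¹ y = signedPerm cs g⁻¹ (signedPerm cs x⁻¹ y) := by
    intro y
    rw [mul_inv_rev, map_mul, Equiv.Perm.mul_apply]
  have hne : signedPerm cs x⁻¹ i ≠ signedPerm cs x⁻¹ (i + 1) :=
    (signedPerm cs _).injective.ne (by omega)
  rw [mul_assoc]
  rcases hne.lt_or_gt with h | h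
  · have e₁ := length_sgen_mul_of_not_desc cs hin h
    have e₂ := length_sgen_mul_of_desc cs hin (w := x * g) (by rw [hxg, hxg]; exact hg m₁ m₂ h)
    omega
  · have e₁ := length_sgen_mul_of_desc cs hin h
    have e₂ := length_sgen_mul_of_not_desc cs hin (w := x * g) (by rw [hxg, hxg]; exact hg m₂ m₁ h)
    omega

/-! ### The factors `v_i` and `u_i` -/

theorem strictAntiOn_tau_pow {p : ℕ} (hp : p ≤ n) :
    StrictAntiOn (signedPerm cs (tau cs p ^ p)⁻¹) (Set.Icc (1 - p : ℤ) p) := by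
  have key : ∀ x ∈ Set.Icc (1 - p : ℤ) p, signedPerm cs (tau cs p ^ p)⁻¹ x = 1 - x := by
    intro x hx
    rw [Set.mem_Icc] at hx
    rw [map_inv, Equiv.Perm.inv_eq_iff_eq, eq_comm]
    rcases le_or_gt 1 x with h | h
    · rw [signedPerm_one_sub, signedPerm_tau_pow cs hp le_rfl h hx.2, if_neg (by omega)]
      ring
    · rw [signedPerm_tau_pow cs hp le_rfl (by omega) (by omega), if_neg (by omega)]
      ring
  intro x hx y hy hxy
  rw [key x hx, key y hy]
  omega

theorem strictMonoOn_of_pos {p : ℕ} {g : W}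
    (hg : StrictMonoOn (signedPerm cs g) (Set.Icc (1 : ℤ) p))
    (hpos : ∀ x ∈ Set.Icc (1 : ℤ) p, 1 ≤ signedPerm cs g x) :
    StrictMonoOn (signedPerm cs g) (Set.Icc (1 - p : ℤ) p) := by
  intro x hx y hy hxy
  rw [Set.mem_Icc] at hx hy
  have ex := signedPerm_one_sub cs g x
  have ey := signedPerm_one_sub cs g y
  rcases le_or_gt 1 x with h | h
  · exact hg ⟨h, hx.2⟩ ⟨by omega, hy.2⟩ hxy
  · have := hpos (1 - x) ⟨by omega, by omega⟩
    rcases le_or_gt 1 y with h' | h'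
    · have := hpos y ⟨h', hy.2⟩
      omega
    · have := hg (a := 1 - y) (b := 1 - x) ⟨by omega, by omega⟩ ⟨by omega, by omega⟩ (by omega)
      omega

theorem signedPerm_tau_pow_inv_mul {k l s : ℕ} (hkl : k ≤ l) (hl : l ≤ n) (hs : s ≤ k) {x : ℤ}
    (h₁ : 1 ≤ x) (h₂ : x ≤ k) :
    signedPerm cs ((tau cs l ^ s)⁻¹ * tau cs k ^ s) x = if x ≤ k - s then x else x + (l - k) := by
  rw [map_mul, map_inv, Equiv.Perm.mul_apply, Equiv.Perm.inv_eq_iff_eq,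
    signedPerm_tau_pow cs (by omega) hs h₁ h₂]
  split_ifs with h
  · rw [signedPerm_tau_pow cs hl (by omega) h₁ (by omega), if_pos (by omega)]
  · rw [signedPerm_tau_pow cs hl (by omega) (by omega) (by omega), if_neg (by omega)]
    ring

section Admissible

variable {cs}
variable {w : W} {z : ℕ} {a : Fin z → ℕ} {c : Fin z → ℤ}

theorem IsAdmissible.mem_parab (h : IsAdmissible cs w z a c) {p : ℕ} (hp : ∀ j, a j ≤ p) :
    w ∈ parab cs p := by
  rw [h.prod_eq]
  refine Subgroup.list_prod_mem _ fun x hx => ?_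
  obtain ⟨j, -, rfl⟩ := List.mem_map.1 hx
  exact zpow_mem (tau_mem_parab cs (hp j)) _

theorem sum_filter_le_eq_add (c : Fin z → ℤ) {r : ℕ} (hr : r < z) :
    ∑ j ∈ Finset.univ.filter (fun j : Fin z => r ≤ (j : ℕ)), c j =
      c ⟨r, hr⟩ + ∑ j ∈ Finset.univ.filter (fun j : Fin z => r + 1 ≤ (j : ℕ)), c j := by
  rw [← Finset.sum_insert (by simp)]
  congr 1
  ext j
  simp only [Finset.mem_filter, Finset.mem_univ, true_and, Finset.mem_insert, Fin.ext_iff]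
  omega

theorem IsAdmissible.strictMonoOn_partial (h : IsAdmissible cs w z a c) (hz : 0 < z) {r : ℕ}
    (hr : r < z) :
    ∀ g : W, g = (((List.finRange z).take r).map fun j => tau cs (a j) ^ c j).prod *
      tau cs (a ⟨r, hr⟩) ^ ∑ j ∈ Finset.univ.filter (fun j : Fin z => r ≤ (j : ℕ)), c j →
    StrictMonoOn (signedPerm cs g⁻¹) (Set.Icc (1 : ℤ) (a ⟨0, hz⟩)) ∧
      Set.MapsTo (signedPerm cs g⁻¹) (Set.Icc (1 : ℤ) (a ⟨0, hz⟩))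
        (Set.Icc (1 : ℤ) (a ⟨r, hr⟩)) := by
  induction r with
  | zero =>
    rintro g rfl
    simp [h.total, StrictMonoOn, Set.MapsTo]
  | succ r ih =>
    rintro g hg
    obtain ⟨hmono, hmaps⟩ := ih (by omega) _ rfl
    obtain ⟨hS₀, hS₁⟩ := h.partialSum (r + 1) (by omega) hr
    have hsum := sum_filter_le_eq_add c (show r < z by omega)
    simp only [Nat.add_sub_cancel] at hS₁
    obtain ⟨s, hs⟩ := Int.eq_ofNat_of_zero_le hS₀
    rw [hs] at hS₁ hsum hg
    have hkl : a ⟨r, by omega⟩ ≤ a ⟨r + 1, hr⟩ := h.mono.monotone (by simp)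
    set k := a ⟨r, by omega⟩ with hk
    set l := a ⟨r + 1, hr⟩ with hl
    have hln : l ≤ n := h.le_n _
    have hsk : s ≤ k := by exact_mod_cast hS₁
    set Q := (((List.finRange z).take r).map fun j => tau cs (a j) ^ c j).prod *
      tau cs k ^ ∑ j ∈ Finset.univ.filter (fun j : Fin z => r ≤ (j : ℕ)), c j with hQ
    have hgQ : g⁻¹ = (tau cs l ^ s)⁻¹ * tau cs k ^ s * Q⁻¹ := by
      have htake : (List.finRange z).take (r + 1) =
          (List.finRange z).take r ++ [⟨r, by omega⟩] := by
        rw [List.take_succ_eq_append_getElem (by simp; omega)]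
        simp
      rw [hg, hQ, htake, hsum, List.map_append, List.prod_append]
      simp only [List.map_cons, List.map_nil, List.prod_singleton, zpow_natCast, ← hk, zpow_add]
      group
    rw [hgQ]
    have happ : ∀ x, signedPerm cs ((tau cs l ^ s)⁻¹ * tau cs k ^ s * Q⁻¹) x =
        signedPerm cs ((tau cs l ^ s)⁻¹ * tau cs k ^ s) (signedPerm cs Q⁻¹ x) := by
      intro x
      rw [map_mul, Equiv.Perm.mul_apply]
    refine ⟨fun x hx y hy hxy => ?_, fun x hx => ?_⟩
    · have h₁ := hmaps hx
      have h₂ := hmaps hy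
      have h₃ := hmono hx hy hxy
      rw [Set.mem_Icc] at h₁ h₂
      rw [happ, happ, signedPerm_tau_pow_inv_mul cs hkl hln hsk h₁.1 h₁.2,
        signedPerm_tau_pow_inv_mul cs hkl hln hsk h₂.1 h₂.2]
      split_ifs <;> omega
    · have h₁ := hmaps hx
      rw [Set.mem_Icc] at h₁ ⊢
      rw [happ, signedPerm_tau_pow_inv_mul cs hkl hln hsk h₁.1 h₁.2]
      split_ifs <;> omega

theorem IsAdmissible.strictMonoOn (h : IsAdmissible cs w z a c) (hz : 0 < z) {p : ℕ}
    (hp : p ≤ a ⟨0, hz⟩) : StrictMonoOn (signedPerm cs w⁻¹) (Set.Icc (1 - p : ℤ) p) := by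
  obtain ⟨z, rfl⟩ : ∃ z', z = z' + 1 := ⟨z - 1, by omega⟩
  have hsum := sum_filter_le_eq_add c (Nat.lt_succ_self z)
  have hempty : Finset.univ.filter (fun j : Fin (z + 1) => z + 1 ≤ (j : ℕ)) = ∅ := by
    ext j
    simp
    omega
  rw [hempty, Finset.sum_empty, add_zero] at hsum
  obtain ⟨hmono, hmaps⟩ := h.strictMonoOn_partial hz (Nat.lt_succ_self z) w (by
    have htake : List.finRange (z + 1) = (List.finRange (z + 1)).take z ++ [⟨z, by omega⟩] := by
      conv_lhs => rw [← List.take_of_length_le (l := List.finRange (z + 1)) (i := z + 1) (by simp),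
        List.take_succ_eq_append_getElem (by simp)]
      simp
    rw [h.prod_eq, hsum, htake, List.map_append, List.prod_append, ← htake]
    simp)
  have hsub : Set.Icc (1 : ℤ) p ⊆ Set.Icc (1 : ℤ) (a ⟨0, hz⟩) :=
    Set.Icc_subset_Icc_right (by exact_mod_cast hp)
  exact strictMonoOn_of_pos cs (hmono.mono hsub) fun x hx => (hmaps (hsub hx)).1

end Admissible

theorem length_alternating_prod {m : ℕ} {p : Fin m → ℕ} (hmono : StrictMono p)
    (hpn : ∀ i, p i ≤ n) {u : Fin (m + 1) → W} (hu : ∀ j : Fin m, u j.castSucc ∈ parab cs (p j))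
    (hu' : ∀ j : Fin m, StrictMonoOn (signedPerm cs (u j.succ)⁻¹) (Set.Icc (1 - p j : ℤ) (p j))) :
    (cs.length (((List.finRange m).map
        (fun j => u j.castSucc * tau cs (p j) ^ (p j))).prod * u (Fin.last m)) : ℤ) =
      (cs.length (u (Fin.last m)) : ℤ) +
        ∑ j : Fin m, (-1 : ℤ) ^ (m - 1 - (j : ℕ)) *
          ((cs.length (tau cs (p j) ^ (p j)) : ℤ) - (cs.length (u j.castSucc) : ℤ)) := by
  induction m with
  | zero => simp
  | succ m ih =>
    have hIH := ih (p := p ∘ Fin.castSucc) (u := u ∘ Fin.castSucc)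
      (hmono.comp Fin.strictMono_castSucc) (fun i => hpn _) (fun j => hu j.castSucc)
      (fun j => hu' j.castSucc)
    simp only [Function.comp_apply] at hIH
    set X := ((List.finRange m).map (fun j => u j.castSucc.castSucc *
      tau cs (p j.castSucc) ^ (p j.castSucc))).prod * u (Fin.last m).castSucc with hX
    set q := p (Fin.last m) with hq
    have hXmem : X ∈ parab cs q := by
      refine mul_mem (Subgroup.list_prod_mem _ fun x hx => ?_) (hu _)
      obtain ⟨j, -, rfl⟩ := List.mem_map.1 hx
      have hle : p j.castSucc ≤ q := hmono.monotone (Fin.le_last _)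
      exact mul_mem (parab_mono cs hle (hu _)) (pow_mem (tau_mem_parab cs hle) _)
    have hprod : ((List.finRange (m + 1)).map
        (fun j => u j.castSucc * tau cs (p j) ^ (p j))).prod = X * tau cs q ^ q := by
      rw [List.finRange_succ_last, List.map_append, List.prod_append, List.map_map]
      simp only [List.map_cons, List.map_nil, List.prod_singleton, hX, mul_assoc]
      rfl
    have e₁ : cs.length (X * tau cs q ^ q) + cs.length X = cs.length (tau cs q ^ q) :=
      length_mul_of_strictAntiOn cs (hpn _) hXmem (strictAntiOn_tau_pow cs (hpn _))
    have e₂ : cs.length (X * tau cs q ^ q * u (Fin.last (m + 1))) =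
        cs.length (X * tau cs q ^ q) + cs.length (u (Fin.last (m + 1))) :=
      length_mul_of_strictMonoOn cs (hpn _)
        (mul_mem hXmem (pow_mem (tau_mem_parab cs le_rfl) q)) (hu' (Fin.last m))
    zify at e₁ e₂
    have hsum : ∑ j : Fin m, (-1 : ℤ) ^ (m - (j : ℕ)) *
          ((cs.length (tau cs (p j.castSucc) ^ (p j.castSucc)) : ℤ) -
            (cs.length (u j.castSucc.castSucc) : ℤ)) =
        -∑ j : Fin m, (-1 : ℤ) ^ (m - 1 - (j : ℕ)) *
          ((cs.length (tau cs (p j.castSucc) ^ (p j.castSucc)) : ℤ) -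
            (cs.length (u j.castSucc.castSucc) : ℤ)) := by
      rw [← Finset.sum_neg_distrib]
      refine Finset.sum_congr rfl fun j _ => ?_
      rw [show m - (j : ℕ) = m - 1 - j + 1 by omega, pow_succ]
      ring
    rw [hprod, Fin.sum_univ_castSucc]
    simp only [Nat.add_sub_cancel, Fin.val_castSucc, Fin.val_last, Nat.sub_self, pow_zero, one_mul]
    rw [hsum]
    linarith

/-- Alternating-sum formula for the Coxeter length of
`π = u_1·v_1·u_2·v_2 ⋯ u_m·v_m·u_{m+1}`, where `v_i = τ_{p_i}^{p_i}` with
`p_1 < p_2 < ⋯ < p_m`, and each `u_i` is either trivial or has an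
`Ṡ_n`-admissible presentation whose `τ`-indices lie between `p_{i-1}` and `p_i`
(the lower constraint for `i ≥ 2` and the upper constraint for `i ≤ m`):
`ℓ(π) = ℓ(u_{m+1}) + Σ_{i=1}^m (-1)^{m-i}·(ℓ(v_i) - ℓ(u_i))`. -/
theorem length_uvuv (cs : CoxeterSystem (BCoxeterMatrix n) W)
    (m : ℕ) (hm : 1 ≤ m)
    (p : Fin m → ℕ) (hmono : StrictMono p) (hp1 : ∀ i, 1 ≤ p i) (hpn : ∀ i, p i ≤ n)
    (u : Fin (m + 1) → W)
    (hu : ∀ idx : Fin (m + 1), u idx = 1 ∨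
      ∃ (z : ℕ) (hz : 0 < z) (a : Fin z → ℕ) (c : Fin z → ℤ),
        IsAdmissible cs (u idx) z a c ∧
        (∀ h1 : 1 ≤ (idx : ℕ),
          p ⟨(idx : ℕ) - 1, by have := idx.isLt; omega⟩ ≤ a ⟨0, hz⟩) ∧
        (∀ h2 : (idx : ℕ) < m, a ⟨z - 1, by omega⟩ ≤ p ⟨(idx : ℕ), h2⟩)) :
    (cs.length (((List.finRange m).map
        (fun j => u j.castSucc * tau cs (p j) ^ (p j))).prod * u (Fin.last m)) : ℤ) =
      (cs.length (u (Fin.last m)) : ℤ) +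
        ∑ j : Fin m, (-1 : ℤ) ^ (m - 1 - (j : ℕ)) *
          ((cs.length (tau cs (p j) ^ (p j)) : ℤ) - (cs.length (u j.castSucc) : ℤ)) := by
  refine length_alternating_prod cs hmono hpn (fun j => ?_) (fun j => ?_)
  · rcases hu j.castSucc with h | ⟨z, hz, a, c, hadm, -, hup⟩
    · rw [h]
      exact one_mem _
    · refine hadm.mem_parab fun i => (hadm.mono.monotone ?_).trans (hup j.isLt)
      rw [Fin.le_def]
      exact Nat.le_sub_one_of_lt i.isLt
  · rcases hu j.succ with h | ⟨z, hz, a, c, hadm, hlow, -⟩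
    · simp [h, StrictMonoOn]
    · exact hadm.strictMonoOn hz (hlow (by simp))
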